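/- arXiv:1812.06713 — 3 statements merged into one kernel-verified Lean document; each statement's English description precedes it below -/
import Mathlib

section
/- Let λ_B, λ_E, σ², h_n, h_f, P be strictly positive reals and define f : ℝ → ℝ by f(p) = λ_E·σ² / (h_n²·p + σ²) + λ_B·(h_f²·p + σ²) / (h_f²·P + σ²). Set p* = (σ / (h_n·h_f)) · Real.sqrt (λ_E·(h_f²·P + σ²) / λ_B) − σ² / h_n², where σ = Real.sqrt σ². Then the unique minimizer of f on the interval [0, P/2] equals min (max p* 0) (P/2). -/
/-- The difference of two values of `p ↦ A / (a * p + s) + c * p`, factored at its stationary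
point `t`. -/
lemma inv_add_linear_sub_eq {A a s c t x y : ℝ} (hx : a * x + s ≠ 0) (hy : a * y + s ≠ 0)
    (ht : c * (a * t + s) ^ 2 = A * a) :
    (A / (a * y + s) + c * y) - (A / (a * x + s) + c * x) =
      c * ((y - x) * ((a * x + s) * (a * y + s) - (a * t + s) ^ 2)) /
        ((a * x + s) * (a * y + s)) := by
  field_simp
  linear_combination (y - x) * ht

/-- The projection onto `[0, b]` of the stationary point `t` is the strict minimizer of
`p ↦ A / (a * p + s) + c * p` on `[0, b]`. -/
lemma inv_add_linear_lt_of_ne_proj {A a s c t b r : ℝ} (ha : 0 < a) (hs : 0 < s) (hc : 0 < c)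
    (hb : 0 < b) (ht : c * (a * t + s) ^ 2 = A * a) (htpos : 0 < a * t + s)
    (hr : r ∈ Set.Icc 0 b) (hne : r ≠ min (max t 0) b) :
    A / (a * min (max t 0) b + s) + c * min (max t 0) b < A / (a * r + s) + c * r := by
  have hq : 0 ≤ min (max t 0) b := le_min (le_max_right _ _) hb.le
  have hlt : min (max t 0) b < r → t ≤ min (max t 0) b := fun h => by
    have h' : max t 0 < b := by
      by_contra! h'
      rw [min_eq_right h'] at h
      exact absurd hr.2 (not_le.2 h)
    rw [min_eq_left h'.le]
    exact le_max_left _ _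
  have hgt : r < min (max t 0) b → min (max t 0) b ≤ t := fun h => by
    have h' : 0 < t := by
      by_contra! h'
      rw [max_eq_right h', min_eq_left hb.le] at h
      exact absurd hr.1 (not_le.2 h)
    rw [max_eq_left h'.le]
    exact min_le_left _ _
  generalize min (max t 0) b = q at *
  have hx : 0 < a * q + s := by positivity
  have hy : 0 < a * r + s := by have := hr.1; positivity
  rw [← sub_pos, inv_add_linear_sub_eq hx.ne' hy.ne' ht]
  refine div_pos (mul_pos hc ?_) (mul_pos hx hy)
  rcases lt_or_gt_of_ne hne with h | h
  · have h1 : a * q + s ≤ a * t + s := by gcongr; exact hgt h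
    have h2 : a * r + s < a * q + s := by gcongr
    exact mul_pos_of_neg_of_neg (sub_neg.2 h) (by nlinarith)
  · have h1 : a * t + s ≤ a * q + s := by gcongr; exact hlt h
    have h2 : a * q + s < a * r + s := by gcongr
    exact mul_pos (sub_pos.2 h) (by nlinarith)

/-- Closed-form solution (Eq. (11)) of the second-stage pairwise power
re-allocation: the unique minimizer of
`f(p) = λ_E·σ²/(h_n²·p + σ²) + λ_B·(h_f²·p + σ²)/(h_f²·P + σ²)` on
`[0, P/2]` is the projection `min (max p* 0) (P/2)` of the stationary
point `p* = (σ/(h_n·h_f))·√(λ_E·(h_f²·P + σ²)/λ_B) − σ²/h_n²` onto the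
interval, where `σ = √σ²`. -/
theorem supcast_reallocation_closed_form
    (lamB lamE σ2 hn hf P : ℝ)
    (hlamB : 0 < lamB) (hlamE : 0 < lamE) (hσ2 : 0 < σ2)
    (hhn : 0 < hn) (hhf : 0 < hf) (hP : 0 < P) :
    let f : ℝ → ℝ := fun p =>
      lamE * σ2 / (hn ^ 2 * p + σ2) +
        lamB * (hf ^ 2 * p + σ2) / (hf ^ 2 * P + σ2)
    let pstar : ℝ :=
      Real.sqrt σ2 / (hn * hf) * Real.sqrt (lamE * (hf ^ 2 * P + σ2) / lamB)
        - σ2 / hn ^ 2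
    let q : ℝ := min (max pstar 0) (P / 2)
    (q ∈ Set.Icc (0 : ℝ) (P / 2) ∧ ∀ r ∈ Set.Icc (0 : ℝ) (P / 2), f q ≤ f r) ∧
    ∀ r ∈ Set.Icc (0 : ℝ) (P / 2),
      (∀ s ∈ Set.Icc (0 : ℝ) (P / 2), f r ≤ f s) → r = q := by
  intro f pstar q
  have hD : 0 < hf ^ 2 * P + σ2 := by positivity
  have hT : hn ^ 2 * pstar + σ2 =
      hn / hf * (Real.sqrt σ2 * Real.sqrt (lamE * (hf ^ 2 * P + σ2) / lamB)) := by
    simp only [pstar]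
    field_simp
    ring
  have hTpos : 0 < hn ^ 2 * pstar + σ2 := by
    rw [hT]
    positivity
  have hstat : lamB * hf ^ 2 / (hf ^ 2 * P + σ2) * (hn ^ 2 * pstar + σ2) ^ 2 =
      lamE * σ2 * hn ^ 2 := by
    rw [hT, mul_pow, mul_pow, Real.sq_sqrt hσ2.le, Real.sq_sqrt (by positivity)]
    field_simp
  have hf_eq : ∀ p, f p = lamE * σ2 / (hn ^ 2 * p + σ2) +
      lamB * hf ^ 2 / (hf ^ 2 * P + σ2) * p + lamB * σ2 / (hf ^ 2 * P + σ2) := fun p => by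
    simp only [f]
    ring
  have hlt : ∀ r ∈ Set.Icc (0 : ℝ) (P / 2), r ≠ q → f q < f r := fun r hr hne => by
    rw [hf_eq, hf_eq]
    exact add_lt_add_left (inv_add_linear_lt_of_ne_proj (by positivity) hσ2 (by positivity)
      (by positivity) hstat hTpos hr hne) _
  have hq : q ∈ Set.Icc (0 : ℝ) (P / 2) :=
    ⟨le_min (le_max_right _ _) (by positivity), min_le_right _ _⟩
  refine ⟨⟨hq, fun r hr => ?_⟩, fun r hr hmin => ?_⟩
  · rcases eq_or_ne r q with rfl | hne
    · exact le_rfl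
    · exact (hlt r hr hne).le
  · by_contra hne
    exact absurd (hmin q hq) (not_le.2 (hlt r hr hne))
end

section
/- Let M ≥ 1 and let D : Fin M → Fin M → ℝ be arbitrary. Then there exists a bijection σ : Fin M ≃ Fin M admitting no blocking pair, i.e., there is no pair (i, j) with D i j < D i (σ i) and D i j < D (σ.symm j) j. -/
/-- A matching `σ` between BL chunks and EL chunks is stable if it admits no
blocking pair `(i, j)`, i.e. no pair with `D i j < D i (σ i)` and
`D i j < D (σ.symm j) j`. -/
def IsStableMatching {M : ℕ} (D : Fin M → Fin M → ℝ) (σ : Fin M ≃ Fin M) : Prop :=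
  ¬ ∃ i j : Fin M, D i j < D i (σ i) ∧ D i j < D (σ.symm j) j

/-- Finitely many real values admit positive integer weights that at least triple whenever the
value strictly decreases. -/
lemma exists_weight_three_mul_le {ι : Type*} [Fintype ι] (f : ι → ℝ) :
    ∃ w : ι → ℕ, (∀ p, 0 < w p) ∧ ∀ p q, f p < f q → 3 * w q ≤ w p := by
  classical
  refine ⟨fun p => 3 ^ (Finset.univ.filter fun r => f p < f r).card, fun p => by positivity, ?_⟩
  intro p q hpq
  have hlt : (Finset.univ.filter fun r => f q < f r).card <
      (Finset.univ.filter fun r => f p < f r).card := by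
    apply Finset.card_lt_card
    rw [Finset.ssubset_iff_of_subset]
    · exact ⟨q, by simp [hpq], by simp⟩
    · intro r hr
      simp only [Finset.mem_filter, Finset.mem_univ, true_and] at hr ⊢
      exact hpq.trans hr
  rw [mul_comm, ← pow_succ]
  exact Nat.pow_le_pow_right (by norm_num) hlt

/-- If `(i, σ k)` outweighs both `(i, σ i)` and `(k, σ k)` together, then exchanging the partners
of `i` and `k` increases the total weight of the matching. -/
lemma sum_lt_sum_swap {α β : Type*} [Fintype α] [DecidableEq α] (w : α × β → ℕ) (σ : α ≃ β)
    {i k : α} (hik : i ≠ k) (h : w (i, σ i) + w (k, σ k) < w (i, σ k)) :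
    ∑ a, w (a, σ a) < ∑ a, w (a, (Equiv.swap i k).trans σ a) := by
  have hk : k ∈ Finset.univ.erase i := by simp [hik.symm]
  have hrest : ∑ a ∈ (Finset.univ.erase i).erase k, w (a, (Equiv.swap i k).trans σ a) =
      ∑ a ∈ (Finset.univ.erase i).erase k, w (a, σ a) := by
    refine Finset.sum_congr rfl fun a ha => ?_
    simp only [Finset.mem_erase, Finset.mem_univ, and_true] at ha
    rw [Equiv.trans_apply, Equiv.swap_apply_of_ne_of_ne ha.2 ha.1]
  rw [← Finset.add_sum_erase _ _ (Finset.mem_univ i), ← Finset.add_sum_erase _ _ hk,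
    ← Finset.add_sum_erase _ (fun a => w (a, (Equiv.swap i k).trans σ a)) (Finset.mem_univ i),
    ← Finset.add_sum_erase _ (fun a => w (a, (Equiv.swap i k).trans σ a)) hk, hrest]
  simp only [Equiv.trans_apply, Equiv.swap_apply_left, Equiv.swap_apply_right]
  omega

/-- Existence of a stable matching (Theorem 1): for any sum-distortion matrix
`D`, some matching between BL and EL chunks admits no blocking pair. -/
theorem exists_stable_matching
    (M : ℕ) (hM : 1 ≤ M) (D : Fin M → Fin M → ℝ) :
    ∃ σ : Fin M ≃ Fin M, IsStableMatching D σ := by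
  obtain ⟨w, hpos, hw⟩ := exists_weight_three_mul_le fun p : Fin M × Fin M => D p.1 p.2
  obtain ⟨σ, hσ⟩ := Finite.exists_max fun σ : Fin M ≃ Fin M => ∑ a, w (a, σ a)
  refine ⟨σ, ?_⟩
  rintro ⟨i, j, hi, hj⟩
  obtain ⟨k, rfl⟩ := σ.surjective j
  rw [Equiv.symm_apply_apply] at hj
  have hik : i ≠ k := by
    rintro rfl
    exact lt_irrefl _ hi
  have h₁ := hw (i, σ k) (i, σ i) hi
  have h₂ := hw (i, σ k) (k, σ k) hj
  have h₃ := hpos (i, σ k)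
  exact (sum_lt_sum_swap w σ hik (by omega)).not_ge (hσ _)
end

section
/- Let M ≥ 1 and let D : Fin M → Fin M → ℝ have pairwise distinct values (D i j = D k l implies i = k and j = l). Then there is exactly one stable matching: if σ₁ and σ₂ are both stable matchings, then σ₁ = σ₂. In particular, the BL-optimal and EL-optimal stable matchings coincide and yield the same total distortion ∑ i, D i (σ i). -/
/-- If `τ` is stable and `i` strictly prefers its `σ`-partner to its `τ`-partner, then some other
index on which the two matchings disagree has a strictly smaller value under `τ`. -/
theorem IsStableMatching.exists_ne_and_lt {M : ℕ} {D : Fin M → Fin M → ℝ}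
    (hdist : ∀ i j k l : Fin M, D i j = D k l → i = k ∧ j = l) {σ τ : Fin M ≃ Fin M}
    (hτ : IsStableMatching D τ) {i : Fin M} (hi : D i (σ i) < D i (τ i)) :
    ∃ k, σ k ≠ τ k ∧ D k (τ k) < D i (σ i) := by
  have hne : τ.symm (σ i) ≠ i := fun h => by
    rw [(Equiv.symm_apply_eq τ).1 h] at hi
    exact lt_irrefl _ hi
  refine ⟨τ.symm (σ i), fun h => hne ?_, ?_⟩
  · rw [Equiv.apply_symm_apply] at h
    exact σ.injective h
  · rw [Equiv.apply_symm_apply]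
    have hle : D (τ.symm (σ i)) (σ i) ≤ D i (σ i) :=
      not_lt.1 fun h => hτ ⟨i, σ i, hi, h⟩
    exact hle.lt_of_ne fun h => hne (hdist _ _ _ _ h).1

/-- Two stable matchings for pairwise distinct values are equal. -/
theorem IsStableMatching.eq {M : ℕ} {D : Fin M → Fin M → ℝ}
    (hdist : ∀ i j k l : Fin M, D i j = D k l → i = k ∧ j = l) {σ τ : Fin M ≃ Fin M}
    (hσ : IsStableMatching D σ) (hτ : IsStableMatching D τ) : σ = τ := by
  by_contra hne
  obtain ⟨i₀, hi₀⟩ : ∃ i, σ i ≠ τ i := by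
    by_contra! h
    exact hne (Equiv.ext h)
  obtain ⟨i, hi, hmin⟩ := Finset.exists_min_image (Finset.univ.filter fun i => σ i ≠ τ i)
    (fun i => min (D i (σ i)) (D i (τ i))) ⟨i₀, by simpa using hi₀⟩
  simp only [Finset.mem_filter, Finset.mem_univ, true_and] at hi hmin
  rcases lt_or_gt_of_ne fun h => hi (hdist _ _ _ _ h).2 with hlt | hlt
  · obtain ⟨k, hk, hklt⟩ := hτ.exists_ne_and_lt hdist hlt
    have hle := (hmin k hk).trans (min_le_right _ _)
    rw [min_eq_left hlt.le] at hle
    exact hle.not_gt hklt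
  · obtain ⟨k, hk, hklt⟩ := hσ.exists_ne_and_lt hdist hlt
    have hle := (hmin k hk.symm).trans (min_le_left _ _)
    rw [min_eq_right hlt.le] at hle
    exact hle.not_gt hklt

/-- Remark 1: when `D` has pairwise distinct values, the stable matching is
unique; in particular the BL-optimal and EL-optimal stable matchings coincide
and yield the same total distortion. -/
theorem stable_matching_unique
    (M : ℕ) (hM : 1 ≤ M) (D : Fin M → Fin M → ℝ)
    (hdist : ∀ i j k l : Fin M, D i j = D k l → i = k ∧ j = l)
    (σ₁ σ₂ : Fin M ≃ Fin M)
    (h₁ : IsStableMatching D σ₁) (h₂ : IsStableMatching D σ₂) :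
    σ₁ = σ₂ ∧ (∑ i, D i (σ₁ i)) = ∑ i, D i (σ₂ i) := by
  obtain rfl := h₁.eq hdist h₂
  exact ⟨rfl, rfl⟩
end
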